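/- Let H be a minimal counterexample to the main theorem: a plane graph with Δ(H)=6, containing no subgraph isomorphic to a diamond or a house, in which every 6-vertex either is not incident with two 4-cycles sharing an edge or is not incident with three cycles of sizes p,q,ℓ for any {p,q,ℓ} ∈ {{3,4,4},{3,3,4}}, that is not totally 7-colorable, and that minimizes |V(H)|+|E(H)| among all such graphs. Then every 4-face of H is incident with at most one vertex of degree 2. -/

import Mathlib

open SimpleGraph

/-- The degree of a vertex, as `Nat.card` of its neighbor set. -/
noncomputable def vdeg {V : Type*} (G : SimpleGraph V) (v : V) : ℕ :=
  Nat.card (G.neighborSet v)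

/-- `G` has maximum degree exactly `k`. -/
def MaxDegreeEq {V : Type*} (G : SimpleGraph V) (k : ℕ) : Prop :=
  (∀ v, vdeg G v ≤ k) ∧ ∃ v, vdeg G v = k

/-- `G` admits a total `k`-coloring: a coloring of vertices and edges with `k` colors such
that adjacent vertices get distinct colors, edges sharing an endpoint get distinct colors,
and each edge gets a color distinct from those of its endpoints. -/
def TotallyColorable {V : Type*} (G : SimpleGraph V) (k : ℕ) : Prop :=
  ∃ (cv : V → Fin k) (ce : Sym2 V → Fin k),
    (∀ ⦃u v⦄, G.Adj u v → cv u ≠ cv v) ∧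
    (∀ e₁ ∈ G.edgeSet, ∀ e₂ ∈ G.edgeSet, e₁ ≠ e₂ → (∃ x, x ∈ e₁ ∧ x ∈ e₂) →
      ce e₁ ≠ ce e₂) ∧
    (∀ ⦃u v⦄, G.Adj u v → ce s(u, v) ≠ cv u)

/-- The diamond: `K₄` minus one edge. -/
def diamondGraph : SimpleGraph (Fin 4) :=
  SimpleGraph.fromEdgeSet {s(0, 1), s(0, 2), s(0, 3), s(1, 2), s(1, 3)}

/-- The house: a `4`-cycle `1 2 3 4` and a triangle `0 1 4` sharing exactly the edge `{1,4}`
(equivalently, a `5`-cycle plus one chord). -/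
def houseGraph : SimpleGraph (Fin 5) :=
  SimpleGraph.fromEdgeSet {s(0, 1), s(1, 2), s(2, 3), s(3, 4), s(4, 0), s(1, 4)}

/-- `G` contains a (not necessarily induced) subgraph isomorphic to `H`. -/
def ContainsCopy {α β : Type*} (H : SimpleGraph α) (G : SimpleGraph β) : Prop :=
  ∃ f : α → β, Function.Injective f ∧ ∀ ⦃u v⦄, H.Adj u v → G.Adj (f u) (f v)

/-- `v` is incident with two distinct `4`-cycles of `G` that share an edge. -/
def TwoAdjacentFourCyclesAt {V : Type*} (G : SimpleGraph V) (v : V) : Prop :=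
  ∃ (c₁ c₂ : G.Walk v v), c₁.IsCycle ∧ c₂.IsCycle ∧ c₁.length = 4 ∧ c₂.length = 4 ∧
    {e | e ∈ c₁.edges} ≠ {e | e ∈ c₂.edges} ∧ ∃ e, e ∈ c₁.edges ∧ e ∈ c₂.edges

/-- `v` is incident with three pairwise distinct cycles of `G`, of lengths `p`, `q`, `ℓ`. -/
def ThreeCyclesAt {V : Type*} (G : SimpleGraph V) (v : V) (p q ℓ : ℕ) : Prop :=
  ∃ (c₁ c₂ c₃ : G.Walk v v), c₁.IsCycle ∧ c₂.IsCycle ∧ c₃.IsCycle ∧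
    c₁.length = p ∧ c₂.length = q ∧ c₃.length = ℓ ∧
    {e | e ∈ c₁.edges} ≠ {e | e ∈ c₂.edges} ∧
    {e | e ∈ c₁.edges} ≠ {e | e ∈ c₃.edges} ∧
    {e | e ∈ c₂.edges} ≠ {e | e ∈ c₃.edges}

/-- Every `6`-vertex of `G` is not incident with two `4`-cycles sharing an edge, or is not
incident with three cycles of sizes `p, q, ℓ` for any `{p,q,ℓ} ∈ {{3,4,4},{3,3,4}}`. -/
def Good6Vertices {V : Type*} (G : SimpleGraph V) : Prop :=
  ∀ v, vdeg G v = 6 →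
    (¬ TwoAdjacentFourCyclesAt G v) ∨
    (∀ p q ℓ : ℕ, (({p, q, ℓ} : Multiset ℕ) = {3, 4, 4} ∨ ({p, q, ℓ} : Multiset ℕ) = {3, 3, 4}) →
      ¬ ThreeCyclesAt G v p q ℓ)

/-- Reversal of darts, as a permutation. -/
def dartRev {V : Type*} (G : SimpleGraph V) : Equiv.Perm G.Dart :=
  Function.Involutive.toPerm SimpleGraph.Dart.symm SimpleGraph.Dart.symm_involutive

/-- A rotation system (combinatorial embedding) of `G`: a permutation of the darts whose
orbits are exactly the sets of darts emanating from each single vertex. -/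
structure RotationSystem {V : Type*} (G : SimpleGraph V) where
  σ : Equiv.Perm G.Dart
  tail_fixed : ∀ d : G.Dart, (σ d).fst = d.fst
  vertex_cycles : ∀ d d' : G.Dart, d.fst = d'.fst → σ.SameCycle d d'

namespace RotationSystem

variable {V : Type*} {G : SimpleGraph V}

/-- The face-tracing permutation of a rotation system. -/
def φ (R : RotationSystem G) : Equiv.Perm G.Dart :=
  R.σ * dartRev G

/-- Two darts lie on the same face iff they are in the same orbit of the face-tracing
permutation. -/
def faceSetoid (R : RotationSystem G) : Setoid G.Dart where
  r := R.φ.SameCycle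
  iseqv := ⟨fun d => Equiv.Perm.SameCycle.refl _ d, Equiv.Perm.SameCycle.symm,
    Equiv.Perm.SameCycle.trans⟩

/-- The faces of the embedding: orbits of the face-tracing permutation. -/
def Faces (R : RotationSystem G) : Type _ :=
  Quotient R.faceSetoid

/-- The number of faces of the embedding. -/
noncomputable def numFaces (R : RotationSystem G) : ℕ :=
  Nat.card R.Faces

/-- The darts of the face containing the dart `d`. -/
def faceDarts (R : RotationSystem G) (d : G.Dart) : Set G.Dart :=
  {d' | R.φ.SameCycle d d'}

/-- The degree (length of the boundary walk, cut edges counted twice) of the face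
containing the dart `d`. -/
noncomputable def faceDeg (R : RotationSystem G) (d : G.Dart) : ℕ :=
  (R.faceDarts d).ncard

/-- The vertex `v` is incident with the face containing the dart `d`. -/
def FaceIncident (R : RotationSystem G) (v : V) (d : G.Dart) : Prop :=
  ∃ d' ∈ R.faceDarts d, d'.fst = v

/-- A rotation system is a plane embedding when it satisfies Euler's formula
`|V| - |E| + |F| = 2` on each connected component, i.e. `|V| + |F| = |E| + 2c`. -/
def IsPlanarEmbedding [Fintype V] (R : RotationSystem G) : Prop :=
  Fintype.card V + R.numFaces = Nat.card G.edgeSet + 2 * Nat.card G.ConnectedComponent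

end RotationSystem

/-- A graph is planar if it admits a plane embedding. -/
def IsPlanar {V : Type*} [Fintype V] (G : SimpleGraph V) : Prop :=
  ∃ R : RotationSystem G, R.IsPlanarEmbedding

/-- Conditions (1), (2), (3) on graphs in Theorem 1: planar of maximum degree 6, with no
diamond and no house subgraph, and every 6-vertex not incident with two adjacent 4-cycles
or not incident with three cycles of sizes in `{{3,4,4},{3,3,4}}`. -/
def GoodGraph {V : Type*} [Fintype V] (G : SimpleGraph V) : Prop :=
  IsPlanar G ∧ MaxDegreeEq G 6 ∧ ¬ ContainsCopy diamondGraph G ∧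
    ¬ ContainsCopy houseGraph G ∧ Good6Vertices G

/-- `H` is a minimal counterexample to the main theorem: it satisfies conditions (1)–(3),
is not totally 7-colorable, and minimizes `|V| + |E|` among all such graphs. -/
def MinimalCounterexample {V : Type*} [Fintype V] (H : SimpleGraph V) : Prop :=
  GoodGraph H ∧ ¬ TotallyColorable H 7 ∧
    ∀ (n : ℕ) (G : SimpleGraph (Fin n)), GoodGraph G → ¬ TotallyColorable G 7 →
      Fintype.card V + Nat.card H.edgeSet ≤ n + Nat.card G.edgeSet

section AbstractMaps

open Equiv

/-- number of classes -/
noncomputable def KK {D : Type*} (r : Setoid D) : ℕ := Nat.card (Quotient r)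

def cycS {D : Type*} (σ : Perm D) : Setoid D := Perm.SameCycle.setoid σ

def genS {D : Type*} (σ α : Perm D) : Setoid D :=
  sInf {s | (∀ x, s x (σ x)) ∧ (∀ x, s x (α x))}

theorem genS_le {D : Type*} {σ α : Perm D} {s : Setoid D}
    (h1 : ∀ x, s x (σ x)) (h2 : ∀ x, s x (α x)) : genS σ α ≤ s :=
  sInf_le ⟨h1, h2⟩

theorem genS_left {D : Type*} (σ α : Perm D) (x : D) : genS σ α x (σ x) := by
  intro s hs; exact hs.1 x

theorem genS_right {D : Type*} (σ α : Perm D) (x : D) : genS σ α x (α x) := by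
  intro s hs; exact hs.2 x

theorem cycS_step {D : Type*} (σ : Perm D) (x : D) : cycS σ x (σ x) :=
  ⟨1, by simp⟩

theorem cycS_le {D : Type*} {σ : Perm D} {s : Setoid D}
    (h1 : ∀ x, s x (σ x)) : cycS σ ≤ s := by
  have hn : ∀ (n : ℕ) x, s x ((σ ^ n) x) := by
    intro n
    induction n with
    | zero => intro x; simpa using s.refl' x
    | succ k ih =>
      intro x
      rw [pow_succ', Perm.mul_apply]
      exact s.trans' (ih x) (h1 _)
  rintro x y ⟨i, rfl⟩
  obtain ⟨n, rfl | rfl⟩ := Int.eq_nat_or_neg i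
  · simpa using hn n x
  · have := hn n ((σ ^ (-(n:ℤ))) x)
    apply s.symm'
    have e : (σ ^ n) ((σ ^ (-(n:ℤ))) x) = x := by simp
    rwa [e] at this

theorem cycS_eq_genS {D : Type*} (σ : Perm D) : cycS σ = genS σ 1 :=
  le_antisymm (cycS_le (genS_left σ 1)) (genS_le (cycS_step σ) (fun x => (cycS σ).refl' x))

theorem cycS_one_eq {D : Type*} (α : Perm D) : cycS α = genS 1 α :=
  le_antisymm (cycS_le (genS_right 1 α)) (genS_le (fun x => (cycS α).refl' x) (cycS_step α))

theorem KK_anti {D : Type*} [Finite D] {r s : Setoid D} (h : r ≤ s) : KK s ≤ KK r := by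
  refine Nat.card_le_card_of_surjective (Quotient.map' id h) ?_
  intro q
  induction q using Quotient.inductionOn with
  | h x => exact ⟨Quotient.mk _ x, rfl⟩

theorem KK_lt {D : Type*} [Finite D] {r s : Setoid D} (h : r ≤ s) {x y : D} (hs : s x y)
    (hr : ¬ r x y) : KK s + 1 ≤ KK r := by
  by_contra hc
  have he : KK s = KK r := le_antisymm (KK_anti h) (by omega)
  have hsurj : Function.Surjective (Quotient.map' id h : Quotient r → Quotient s) := by
    intro q
    induction q using Quotient.inductionOn with
    | h x => exact ⟨Quotient.mk _ x, rfl⟩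
  have hb := (Nat.bijective_iff_surjective_and_card _).2 ⟨hsurj, he.symm⟩
  apply hr
  have : (Quotient.mk r x) = Quotient.mk r y := by
    apply hb.1
    exact Quotient.sound hs
  exact Quotient.exact this

theorem KK_join {D : Type*} [Finite D] {r r2 : Setoid D} (x y : D)
    (h : ∀ s : Setoid D, r ≤ s → s x y → r2 ≤ s) : KK r ≤ KK r2 + 1 := by
  classical
  let f : D → Quotient r := fun p =>
    if (Quotient.mk r p) = Quotient.mk r y then Quotient.mk r x else Quotient.mk r p
  have h1 : r2 ≤ Setoid.ker f := by
    apply h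
    · intro p q hpq
      have : Quotient.mk r p = Quotient.mk r q := Quotient.sound hpq
      simp [Setoid.ker_def, f, this]
    · simp [Setoid.ker_def, f]
  have h2 := KK_anti h1
  have h3 : KK (Setoid.ker f) = Nat.card (Set.range f) :=
    Nat.card_congr (Setoid.quotientKerEquivRange f)
  have h4 : Nat.card (Quotient r) ≤ Nat.card (Option (Set.range f)) := by
    refine Nat.card_le_card_of_surjective (fun o : Option (Set.range f) => match o with
      | none => Quotient.mk r y
      | some z => z.1) ?_
    intro q
    by_cases hq : q = Quotient.mk r y
    · exact ⟨none, hq.symm⟩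
    · induction q using Quotient.inductionOn with
      | h p => exact ⟨some ⟨_, p, rfl⟩, by simp [f, hq]⟩
  rw [Finite.card_option] at h4
  unfold KK at *
  omega

/-- left multiplication by a swap -/
theorem swap_rel {D : Type*} [DecidableEq D] (π : Perm D) (x y : D) (s : Setoid D)
    (h : ∀ z, s z (π z)) (hxy : s x y) : ∀ z, s z ((swap x y * π) z) := by
  intro z
  rw [Perm.mul_apply]
  rcases eq_or_ne (π z) x with h1 | h1
  · rw [h1, swap_apply_left]; exact s.trans' (h1 ▸ h z) hxy
  rcases eq_or_ne (π z) y with h2 | h2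
  · rw [h2, swap_apply_right]; exact s.trans' (h2 ▸ h z) (s.symm' hxy)
  · rw [swap_apply_of_ne_of_ne h1 h2]; exact h z

theorem orb_swap_le {D : Type*} [Finite D] [DecidableEq D] (π : Perm D) (x y : D) :
    KK (cycS (swap x y * π)) ≤ KK (cycS π) + 1 := by
  apply KK_join x y
  intro s hs hxy
  apply cycS_le
  have := swap_rel (swap x y * π) x y s (fun z => hs (cycS_step _ z)) hxy
  simpa [← mul_assoc] using this

theorem orb_swap_merge {D : Type*} [Finite D] [DecidableEq D] (π : Perm D) (x y : D)
    (hxy : ¬ cycS π x y) :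
    KK (cycS (swap x y * π)) + 1 ≤ KK (cycS π) := by
  have key : cycS (swap x y * π) x y := by
    set τ := swap x y * π with hτ
    -- iterate from y
    by_contra hc
    have hit : ∀ n : ℕ, cycS τ y ((π ^ n) y) := by
      intro n
      induction n with
      | zero => simpa using (cycS τ).refl' y
      | succ k ih =>
        rw [pow_succ', Perm.mul_apply]
        have h1 : π ((π ^ k) y) ≠ x := by
          intro h
          apply hxy
          apply (cycS π).symm'
          refine ⟨(k+1 : ℕ), ?_⟩
          rw [zpow_natCast, pow_succ', Perm.mul_apply, h]
        by_cases h2 : π ((π ^ k) y) = y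
        · rw [h2]
        · have := cycS_step τ ((π ^ k) y)
          rw [hτ, Perm.mul_apply, swap_apply_of_ne_of_ne h1 h2] at this
          exact (cycS τ).trans' ih this
    have hs : Perm.SameCycle π y (π⁻¹ y) := ⟨-1, by simp⟩
    obtain ⟨n, hn⟩ := hs.exists_nat_pow_eq
    have h3 := hit n
    rw [hn] at h3
    have h4 := cycS_step τ (π⁻¹ y)
    rw [hτ, Perm.mul_apply, show π (π⁻¹ y) = y by simp, swap_apply_right] at h4
    exact hc ((cycS τ).symm' ((cycS τ).trans' h3 h4))
  refine KK_lt ?_ key hxy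
  apply cycS_le
  have := swap_rel (swap x y * π) x y _ (cycS_step _) key
  simpa [← mul_assoc] using this

noncomputable def gg {D : Type*} (σ α : Perm D) : ℤ :=
  Nat.card D + 2 * KK (genS σ α) - KK (cycS σ) - KK (cycS α) - KK (cycS (σ * α))

theorem gg_merge {D : Type*} [Finite D] [DecidableEq D] (σ α : Perm D) (x y : D)
    (hxy : ¬ cycS σ x y) : gg σ α ≤ gg (swap x y * σ) α := by
  have h1 := orb_swap_merge σ x y hxy
  unfold gg
  by_cases hc : genS σ α x y
  · have h2 : KK (genS σ α) ≤ KK (genS (swap x y * σ) α) :=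
      KK_anti (genS_le (swap_rel σ x y _ (genS_left σ α) hc) (genS_right σ α))
    have h3 := orb_swap_le (σ * α) x y
    rw [← mul_assoc] at h3
    omega
  · have h2 : KK (genS σ α) ≤ KK (genS (swap x y * σ) α) + 1 := by
      apply KK_join x y
      intro s hs hxy
      exact genS_le (swap_rel σ x y s (fun z => hs (genS_left σ α z)) hxy)
        (fun z => hs (genS_right σ α z))
    have h3 : KK (cycS (swap x y * (σ * α))) + 1 ≤ KK (cycS (σ * α)) := by
      apply orb_swap_merge
      intro h
      apply hc
      refine (cycS_le (s := genS σ α) ?_) h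
      intro z
      exact (genS σ α).trans' (genS_right σ α z) (genS_left σ α (α z))
    rw [← mul_assoc] at h3
    omega

def isoD {D : Type*} [DecidableEq D] (σ : Perm D) (x : D) : Perm D := swap x (σ x) * σ

theorem isoD_self {D : Type*} [DecidableEq D] (σ : Perm D) (x : D) : isoD σ x x = x := by
  simp [isoD]

theorem isoD_fix {D : Type*} [DecidableEq D] (σ : Perm D) (x z : D) (h : σ z = z) :
    isoD σ x z = z := by
  by_cases hz : z = x
  · subst hz; exact isoD_self _ _
  · rw [isoD, Perm.mul_apply, h, swap_apply_of_ne_of_ne hz]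
    intro h2
    exact hz (σ.injective (h.trans h2))

theorem gg_isoD {D : Type*} [Finite D] [DecidableEq D] (σ α : Perm D) (x : D) :
    gg (isoD σ x) α ≤ gg σ α := by
  by_cases h : σ x = x
  · have e : isoD σ x = σ := by
      ext z
      simp [isoD, h]
    rw [e]
  have h1 := gg_merge (isoD σ x) α x (σ x) (by
    rintro ⟨i, hi⟩
    have : ((isoD σ x) ^ i) x = x := Perm.zpow_apply_eq_self_of_apply_eq_self (isoD_self σ x) i
    exact h (hi.symm.trans this))
  simpa [isoD, ← mul_assoc] using h1

theorem KK_bot {D : Type*} (α : Perm D) (h : α = 1) : KK (cycS α) = Nat.card D := by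
  subst h
  refine (Nat.card_congr (Equiv.ofBijective (Quotient.mk _) ⟨?_, Quotient.mk_surjective⟩)).symm
  intro x y h
  obtain ⟨i, hi⟩ := Quotient.exact h
  simpa using hi

theorem gg_nonneg {D : Type*} [Finite D] [DecidableEq D] (σ α : Perm D) : 0 ≤ gg σ α := by
  have := Fintype.ofFinite D
  induction hn : σ.support.card using Nat.strong_induction_on generalizing σ with
  | _ n ih =>
  by_cases h : σ = 1
  · subst h
    unfold gg
    rw [KK_bot 1 rfl, one_mul, ← cycS_one_eq]
    omega
  · obtain ⟨x, hx⟩ : ∃ x, σ x ≠ x := by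
      by_contra hc
      push Not at hc
      exact h (Equiv.ext hc)
    refine le_trans ?_ (gg_isoD σ α x)
    refine ih _ ?_ (isoD σ x) rfl
    rw [← hn]
    apply Finset.card_lt_card
    rw [Finset.ssubset_iff_of_subset]
    · exact ⟨x, by simpa using hx, by simp [isoD_self]⟩
    · intro z hz
      rw [Perm.mem_support] at hz ⊢
      exact fun h => hz (isoD_fix σ x z h)

theorem gg_comm {D : Type*} [Finite D] (σ α : Perm D) : gg σ α = gg α σ := by
  have h1 : genS σ α = genS α σ :=
    le_antisymm (genS_le (genS_right _ _) (genS_left _ _))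
      (genS_le (genS_right _ _) (genS_left _ _))
  have h2 : ∀ σ α : Perm D, KK (cycS (σ * α)) ≤ KK (cycS (α * σ)) := by
    intro σ α
    refine Nat.card_le_card_of_surjective (Quotient.map' (fun x => σ x)
      (?_ : ∀ a b, cycS (α * σ) a b → cycS (σ * α) (σ a) (σ b))) ?_
    · intro a b h
      refine cycS_le (s := (cycS (σ * α)).comap σ) ?_ h
      intro x
      exact cycS_step (σ * α) (σ x)
    · intro q
      induction q using Quotient.inductionOn with
      | h x => exact ⟨Quotient.mk _ (σ⁻¹ x), by simp⟩
  have := h2 σ α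
  have := h2 α σ
  unfold gg
  rw [h1]
  omega

/-- removal of isolated darts -/
theorem KK_remove {D D' : Type*} [Finite D] (ι : D' → D) (hι : Function.Injective ι)
    (σ α : Perm D) (σ' α' : Perm D') (hσ : ∀ x, ι (σ' x) = σ (ι x))
    (hα : ∀ x, ι (α' x) = α (ι x)) (hfix : ∀ x, x ∉ Set.range ι → σ x = x ∧ α x = x) :
    KK (genS σ α) = KK (genS σ' α') + Nat.card ↥(Set.range ι)ᶜ := by
  have : Finite D' := Finite.of_injective ι hι
  unfold KK
  rw [← Nat.card_sum]
  symm
  -- the classes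
  let t : Setoid D :=
    { r := fun x y => (∃ x' y', ι x' = x ∧ ι y' = y ∧ genS σ' α' x' y') ∨ x = y
      iseqv := ⟨fun x => Or.inr rfl, by
        rintro x y (⟨x', y', rfl, rfl, h⟩ | rfl)
        · exact Or.inl ⟨_, _, rfl, rfl, (genS σ' α').symm' h⟩
        · exact Or.inr rfl, by
        rintro x y z (⟨x', y', rfl, rfl, h⟩ | rfl) (⟨y'', z', h1, rfl, h'⟩ | rfl)
        · obtain rfl := hι h1
          exact Or.inl ⟨_, _, rfl, rfl, (genS σ' α').trans' h h'⟩
        · exact Or.inl ⟨_, _, rfl, rfl, h⟩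
        · exact Or.inl ⟨_, _, h1, rfl, h'⟩
        · exact Or.inr rfl⟩ }
  have ht : genS σ α ≤ t := by
    apply genS_le
    · intro x
      by_cases hx : x ∈ Set.range ι
      · obtain ⟨x', rfl⟩ := hx
        exact Or.inl ⟨x', σ' x', rfl, hσ x', genS_left _ _ _⟩
      · exact Or.inr (hfix x hx).1.symm
    · intro x
      by_cases hx : x ∈ Set.range ι
      · obtain ⟨x', rfl⟩ := hx
        exact Or.inl ⟨x', α' x', rfl, hα x', genS_right _ _ _⟩
      · exact Or.inr (hfix x hx).2.symm
  have hm : ∀ a b, genS σ' α' a b → genS σ α (ι a) (ι b) := by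
    intro a b h
    refine genS_le (s := (genS σ α).comap ι) ?_ ?_ h
    · intro x
      change genS σ α (ι x) (ι (σ' x))
      rw [hσ]; exact genS_left _ _ _
    · intro x
      change genS σ α (ι x) (ι (α' x))
      rw [hα]; exact genS_right _ _ _
  let F : Quotient (genS σ' α') ⊕ ↥(Set.range ι)ᶜ → Quotient (genS σ α) :=
    Sum.elim (Quotient.map' ι hm) (fun z => Quotient.mk _ z.1)
  refine Nat.card_congr (Equiv.ofBijective F ⟨?_, ?_⟩)
  · rintro (p | p) (q | q) h
    · induction p using Quotient.inductionOn with | h p =>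
      induction q using Quotient.inductionOn with | h q =>
      congr 1
      rcases ht (Quotient.exact h) with ⟨a, b, ha, hb, hab⟩ | hpq
      · obtain rfl := hι ha
        obtain rfl := hι hb
        exact Quotient.sound hab
      · rw [hι hpq]
    · induction p using Quotient.inductionOn with | h p =>
      exfalso
      rcases ht (Quotient.exact h) with ⟨a, b, ha, hb, hab⟩ | hpq
      · exact q.2 ⟨b, hb⟩
      · exact q.2 ⟨_, hpq⟩
    · induction q using Quotient.inductionOn with | h q =>
      exfalso
      rcases ht (Quotient.exact h) with ⟨a, b, ha, hb, hab⟩ | hpq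
      · exact p.2 ⟨a, ha⟩
      · exact p.2 ⟨_, hpq.symm⟩
    · congr 1
      apply Subtype.ext
      rcases ht (Quotient.exact h) with ⟨a, b, ha, hb, hab⟩ | hpq
      · exact (p.2 ⟨a, ha⟩).elim
      · exact hpq
  · intro q
    induction q using Quotient.inductionOn with | h q =>
    by_cases hq : q ∈ Set.range ι
    · obtain ⟨x, rfl⟩ := hq
      exact ⟨Sum.inl (Quotient.mk _ x), rfl⟩
    · exact ⟨Sum.inr ⟨q, hq⟩, rfl⟩

theorem gg_remove {D D' : Type*} [Finite D] (ι : D' → D) (hι : Function.Injective ι)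
    (σ α : Perm D) (σ' α' : Perm D') (hσ : ∀ x, ι (σ' x) = σ (ι x))
    (hα : ∀ x, ι (α' x) = α (ι x)) (hfix : ∀ x, x ∉ Set.range ι → σ x = x ∧ α x = x) :
    gg σ α = gg σ' α' := by
  have : Finite D' := Finite.of_injective ι hι
  have h1 := KK_remove ι hι σ α σ' α' hσ hα hfix
  have h2 := KK_remove ι hι σ 1 σ' 1 hσ (fun _ => rfl) (fun x hx => ⟨(hfix x hx).1, rfl⟩)
  have h3 := KK_remove ι hι α 1 α' 1 hα (fun _ => rfl) (fun x hx => ⟨(hfix x hx).2, rfl⟩)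
  have h4 := KK_remove ι hι (σ * α) 1 (σ' * α') 1 (fun x => by simp [hσ, hα])
    (fun _ => rfl) (fun x hx => ⟨by simp [hfix x hx], rfl⟩)
  have h5 : Nat.card D = Nat.card D' + Nat.card ↥(Set.range ι)ᶜ := by
    classical
    rw [Nat.card_congr (Equiv.ofInjective ι hι), ← Nat.card_sum]
    exact (Nat.card_congr (Equiv.Set.sumCompl _)).symm
  simp only [← cycS_eq_genS] at h2 h3 h4
  unfold gg
  omega

theorem isoD_sameCycle {D : Type*} [DecidableEq D] (σ : Perm D) (a x y : D)
    (h : σ.SameCycle x y) (hx : x ≠ a) (hy : y ≠ a) : (isoD σ a).SameCycle x y := by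
  have key : cycS σ ≤ (cycS (isoD σ a)).comap (fun x => if x = a then σ a else x) := by
    apply cycS_le
    intro z
    change cycS _ (if z = a then σ a else z) (if σ z = a then σ a else σ z)
    by_cases hz : z = a
    · subst hz
      simp only [ite_self, if_true]
      exact (cycS _).refl' _
    · rw [if_neg hz]
      have h1 := cycS_step (isoD σ a) z
      by_cases hz2 : σ z = a
      · rw [if_pos hz2]
        rwa [isoD, Perm.mul_apply, hz2, swap_apply_left] at h1
      · rw [if_neg hz2]
        rwa [isoD, Perm.mul_apply, swap_apply_of_ne_of_ne hz2 (fun h => hz (σ.injective h))] at h1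
  have := key h
  change cycS _ (if x = a then σ a else x) (if y = a then σ a else y) at this
  rwa [if_neg hx, if_neg hy] at this

end AbstractMaps

section GraphPart

open Equiv

theorem dart_finite {V : Type*} [Finite V] (G : SimpleGraph V) : Finite G.Dart :=
  Finite.of_injective (fun d => d.toProd) (fun _ _ h => SimpleGraph.Dart.ext _ _ h)

theorem dartRev_apply {V : Type*} (G : SimpleGraph V) (d : G.Dart) : dartRev G d = d.symm := rfl

theorem orb_alpha {V : Type*} [Fintype V] (G : SimpleGraph V) :
    KK (cycS (dartRev G)) = Nat.card G.edgeSet := by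
  have hle : cycS (dartRev G) ≤ Setoid.ker (fun d : G.Dart => d.edge) := by
    apply cycS_le
    intro x
    rw [Setoid.ker_def, dartRev_apply, SimpleGraph.Dart.edge_symm]
  refine Nat.card_congr (Equiv.ofBijective
    (Quotient.lift (fun d : G.Dart => (⟨d.edge, d.edge_mem⟩ : G.edgeSet))
      (fun a b h => Subtype.ext (hle h))) ⟨?_, ?_⟩)
  · intro p q h
    induction p using Quotient.inductionOn with | h p =>
    induction q using Quotient.inductionOn with | h q =>
    have h2 : p.edge = q.edge := congrArg Subtype.val h
    apply Quotient.sound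
    rcases SimpleGraph.dart_edge_eq_iff _ _ |>.1 h2 with rfl | h3
    · exact (cycS _).refl' _
    · apply (cycS _).symm'
      rw [h3, ← dartRev_apply]
      exact cycS_step _ _
  · rintro ⟨e, he⟩
    induction e using Sym2.ind with | _ u v =>
    exact ⟨Quotient.mk _ ⟨(u, v), he⟩, rfl⟩

theorem dart_card {V : Type*} [Fintype V] (G : SimpleGraph V) :
    Nat.card G.Dart = 2 * Nat.card G.edgeSet := by
  classical
  have := G.dart_card_eq_twice_card_edges
  rw [Nat.card_eq_fintype_card, this, Nat.card_eq_fintype_card, SimpleGraph.edgeFinset_card]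

theorem orb_sigma {V : Type*} [Fintype V] {G : SimpleGraph V} (R : RotationSystem G) :
    Nat.card V = KK (cycS R.σ) + Nat.card {v // ∀ w, ¬ G.Adj v w} := by
  have := dart_finite G
  unfold KK
  rw [← Nat.card_sum]
  symm
  have hle : cycS R.σ ≤ Setoid.ker (fun d : G.Dart => d.fst) := by
    apply cycS_le
    intro x
    rw [Setoid.ker_def, R.tail_fixed]
  refine Nat.card_congr (Equiv.ofBijective (Sum.elim
    (Quotient.lift (fun d : G.Dart => d.fst) (fun a b h => hle h)) Subtype.val) ⟨?_, ?_⟩)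
  · rintro (p | p) (q | q) h
    · induction p using Quotient.inductionOn with | h p =>
      induction q using Quotient.inductionOn with | h q =>
      congr 1
      exact Quotient.sound (R.vertex_cycles p q h)
    · induction p using Quotient.inductionOn with | h p =>
      exfalso
      have h : p.fst = q.1 := h
      exact q.2 p.snd (h ▸ p.adj)
    · induction q using Quotient.inductionOn with | h q =>
      exfalso
      have h : p.1 = q.fst := h
      exact p.2 q.snd (h ▸ q.adj)
    · exact congrArg Sum.inr (Subtype.ext h)
  · intro v
    by_cases hv : ∀ w, ¬ G.Adj v w
    · exact ⟨Sum.inr ⟨v, hv⟩, rfl⟩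
    · push Not at hv
      obtain ⟨w, hw⟩ := hv
      exact ⟨Sum.inl (Quotient.mk _ ⟨(v, w), hw⟩), rfl⟩

theorem comp_walk {V : Type*} {G : SimpleGraph V} (R : RotationSystem G) {u v : V}
    (p : G.Walk u v) : ∀ d d' : G.Dart, d.fst = u → d'.fst = v →
      genS R.σ (dartRev G) d d' := by
  have hσ : ∀ d d' : G.Dart, d.fst = d'.fst → genS R.σ (dartRev G) d d' := by
    intro d d' h
    exact cycS_le (genS_left R.σ (dartRev G)) (R.vertex_cycles d d' h)
  induction p with
  | nil =>
    intro d d' h h'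
    exact hσ d d' (h.trans h'.symm)
  | cons hadj p ih =>
    rename_i a b c
    intro d d' h h'
    refine (genS R.σ (dartRev G)).trans' (hσ d ⟨(a, b), hadj⟩ h) ?_
    refine (genS R.σ (dartRev G)).trans' (genS_right _ _ _) ?_
    exact ih _ d' rfl h'

theorem comp_count {V : Type*} [Fintype V] {G : SimpleGraph V} (R : RotationSystem G) :
    Nat.card G.ConnectedComponent =
      KK (genS R.σ (dartRev G)) + Nat.card {v // ∀ w, ¬ G.Adj v w} := by
  have := dart_finite G
  unfold KK
  rw [← Nat.card_sum]
  symm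
  have hle : genS R.σ (dartRev G) ≤
      Setoid.ker (fun d : G.Dart => G.connectedComponentMk d.fst) := by
    apply genS_le
    · intro x
      rw [Setoid.ker_def, R.tail_fixed]
    · intro x
      rw [Setoid.ker_def]
      exact SimpleGraph.ConnectedComponent.sound x.adj.reachable
  have hiso : ∀ u v : V, (∀ w, ¬ G.Adj u w) → G.Reachable u v → u = v := by
    rintro u v hu ⟨p⟩
    cases p with
    | nil => rfl
    | cons h _ => exact (hu _ h).elim
  refine Nat.card_congr (Equiv.ofBijective (Sum.elim
    (Quotient.lift (fun d : G.Dart => G.connectedComponentMk d.fst) (fun a b h => hle h))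
    (fun v => G.connectedComponentMk v.1)) ⟨?_, ?_⟩)
  · rintro (p | p) (q | q) h
    · induction p using Quotient.inductionOn with | h p =>
      induction q using Quotient.inductionOn with | h q =>
      congr 1
      obtain ⟨w⟩ := SimpleGraph.ConnectedComponent.exact h
      exact Quotient.sound (comp_walk R w p q rfl rfl)
    · induction p using Quotient.inductionOn with | h p =>
      exfalso
      have h := SimpleGraph.ConnectedComponent.exact h
      have h := hiso _ _ q.2 h.symm
      exact q.2 p.snd (h ▸ p.adj)
    · induction q using Quotient.inductionOn with | h q =>
      exfalso
      have h := SimpleGraph.ConnectedComponent.exact h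
      have h := hiso _ _ p.2 h
      exact p.2 q.snd (h ▸ q.adj)
    · exact congrArg Sum.inr (Subtype.ext
        (hiso _ _ p.2 (SimpleGraph.ConnectedComponent.exact h)))
  · intro c
    induction c using SimpleGraph.ConnectedComponent.ind with | _ v =>
    by_cases hv : ∀ w, ¬ G.Adj v w
    · exact ⟨Sum.inr ⟨v, hv⟩, rfl⟩
    · push Not at hv
      obtain ⟨w, hw⟩ := hv
      exact ⟨Sum.inl (Quotient.mk _ ⟨(v, w), hw⟩), rfl⟩

theorem planar_iff {V : Type*} [Fintype V] {G : SimpleGraph V} (R : RotationSystem G) :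
    R.IsPlanarEmbedding ↔ gg R.σ (dartRev G) + Nat.card {v // ∀ w, ¬ G.Adj v w} = 0 := by
  have h1 := orb_alpha G
  have h2 := dart_card G
  have h3 := orb_sigma R
  have h4 := comp_count R
  have h5 : R.numFaces = KK (cycS (R.σ * dartRev G)) := rfl
  rw [Nat.card_eq_fintype_card] at h3
  unfold RotationSystem.IsPlanarEmbedding gg
  omega

/-- Planarity of a graph obtained by deleting an edge (and relabelling). -/
theorem planar_delete {V W : Type*} [Fintype V] [Fintype W] {G : SimpleGraph V}
    (R : RotationSystem G) (hR : R.IsPlanarEmbedding) (G' : SimpleGraph W) (f : W → V)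
    (hf : Function.Injective f) (u v : V) (huv : G.Adj u v)
    (hG' : ∀ x y, G'.Adj x y ↔ G.Adj (f x) (f y) ∧ s(f x, f y) ≠ s(u, v))
    (hsurj : Function.Surjective f)
    (hiso : ∀ x, ∃ y, G'.Adj x y) : IsPlanar G' := by
  classical
  have := dart_finite G
  let a : G.Dart := ⟨(u, v), huv⟩
  let b : G.Dart := a.symm
  have hg0 : gg R.σ (dartRev G) = 0 := by
    have h1 := (planar_iff R).1 hR
    have h2 := gg_nonneg R.σ (dartRev G)
    omega
  let σ1 := isoD (isoD R.σ a) b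
  let α1 := isoD (dartRev G) a
  have hg1 : gg σ1 α1 = 0 := by
    apply le_antisymm _ (gg_nonneg _ _)
    calc gg σ1 α1 ≤ gg (isoD R.σ a) α1 := gg_isoD _ _ _
      _ ≤ gg R.σ α1 := gg_isoD _ _ _
      _ = gg α1 R.σ := gg_comm _ _
      _ ≤ gg (dartRev G) R.σ := gg_isoD _ _ _
      _ = gg R.σ (dartRev G) := gg_comm _ _
      _ = 0 := hg0
  have hσa : σ1 a = a := isoD_fix _ _ _ (isoD_self _ _)
  have hσb : σ1 b = b := isoD_self _ _
  have hαa : α1 a = a := isoD_self _ _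
  have hba : dartRev G b = a := by rw [dartRev_apply]; exact SimpleGraph.Dart.symm_symm a
  have hab : dartRev G a = b := rfl
  have hαb : α1 b = b := by
    change swap a (dartRev G a) (dartRev G b) = b
    rw [hba, hab, swap_apply_left]
  let ι : G'.Dart → G.Dart := fun d => ⟨(f d.fst, f d.snd), ((hG' _ _).1 d.adj).1⟩
  have hι : Function.Injective ι := by
    intro d d' h
    have h1 : f d.fst = f d'.fst := congrArg (fun z : G.Dart => z.fst) h
    have h2 : f d.snd = f d'.snd := congrArg (fun z : G.Dart => z.snd) h
    exact SimpleGraph.Dart.ext _ _ (Prod.ext (hf h1) (hf h2))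
  have hr : ∀ x : G.Dart, x ∈ Set.range ι ↔ x ≠ a ∧ x ≠ b := by
    intro x
    have hx : x ≠ a ∧ x ≠ b ↔ s(x.fst, x.snd) ≠ s(u, v) := by
      have : x.edge = a.edge ↔ _ := SimpleGraph.dart_edge_eq_iff x a
      rw [← not_or, ← this]
      rfl
    rw [hx]
    constructor
    · rintro ⟨d, rfl⟩
      exact ((hG' _ _).1 d.adj).2
    · intro h
      obtain ⟨p, hp⟩ := hsurj x.fst
      obtain ⟨q, hq⟩ := hsurj x.snd
      refine ⟨⟨(p, q), (hG' _ _).2 ⟨?_, ?_⟩⟩, ?_⟩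
      · rw [hp, hq]; exact x.adj
      · rw [hp, hq]; exact h
      · exact SimpleGraph.Dart.ext _ _ (Prod.ext hp hq)
  have hpres : ∀ x, σ1 x ∈ Set.range ι ↔ x ∈ Set.range ι := by
    intro x
    rw [hr, hr]
    constructor
    · rintro ⟨h1, h2⟩
      constructor
      · rintro rfl; exact h1 hσa
      · rintro rfl; exact h2 hσb
    · rintro ⟨h1, h2⟩
      constructor
      · intro h; exact h1 (σ1.injective (h.trans hσa.symm))
      · intro h; exact h2 (σ1.injective (h.trans hσb.symm))
  let e : G'.Dart ≃ Set.range ι := Equiv.ofInjective ι hι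
  let σ' : Perm G'.Dart := e.symm.permCongr (σ1.subtypePerm hpres)
  have hσ' : ∀ x, ι (σ' x) = σ1 (ι x) := by
    intro x
    change ι (e.symm (σ1.subtypePerm hpres (e x))) = _
    have : ∀ z, ι (e.symm z) = z.1 := fun z => congrArg Subtype.val (e.apply_symm_apply z)
    rw [this]
    rfl
  have hα' : ∀ x, ι (dartRev G' x) = α1 (ι x) := by
    intro x
    have hx := (hr (ι x)).1 ⟨x, rfl⟩
    have h1 : ι (dartRev G' x) = dartRev G (ι x) := rfl
    rw [h1]
    change _ = swap a (dartRev G a) (dartRev G (ι x))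
    rw [hab, swap_apply_of_ne_of_ne]
    · intro h; exact hx.2 ((dartRev G).injective (h.trans hba.symm))
    · intro h; exact hx.1 ((dartRev G).injective (h.trans hab.symm))
  have htail : ∀ d, (σ1 d).fst = d.fst := by
    have h0 : ∀ (σ : Perm G.Dart) (c : G.Dart), (∀ d, (σ d).fst = d.fst) →
        ∀ d, (isoD σ c d).fst = d.fst := by
      intro σ c h d
      change (swap c (σ c) (σ d)).fst = d.fst
      rcases eq_or_ne (σ d) c with h1 | h1
      · rw [h1, swap_apply_left, h, ← h1, h]
      rcases eq_or_ne (σ d) (σ c) with h2 | h2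
      · rw [h2, swap_apply_right, σ.injective h2]
      · rw [swap_apply_of_ne_of_ne h1 h2, h]
    exact h0 _ _ (h0 _ _ R.tail_fixed)
  let R' : RotationSystem G' :=
    { σ := σ'
      tail_fixed := by
        intro d
        apply hf
        have := congrArg (fun z : G.Dart => z.fst) (hσ' d)
        exact this.trans (htail _)
      vertex_cycles := by
        intro d d' h
        have h1 : R.σ.SameCycle (ι d) (ι d') := R.vertex_cycles _ _ (congrArg f h)
        have hd := (hr (ι d)).1 ⟨d, rfl⟩
        have hd' := (hr (ι d')).1 ⟨d', rfl⟩
        have h2 := isoD_sameCycle _ b _ _ (isoD_sameCycle _ a _ _ h1 hd.1 hd'.1) hd.2 hd'.2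
        obtain ⟨n, hn⟩ := h2.exists_nat_pow_eq
        refine ⟨(n : ℤ), hι ?_⟩
        rw [← hn, zpow_natCast]
        have : ∀ (n : ℕ) x, ι ((σ' ^ n) x) = (σ1 ^ n) (ι x) := by
          intro n
          induction n with
          | zero => intro x; rfl
          | succ k ih =>
            intro x
            rw [pow_succ', pow_succ', Perm.mul_apply, Perm.mul_apply, hσ', ih]
        exact this n d }
  refine ⟨R', (planar_iff R').2 ?_⟩
  have hgg : gg σ1 α1 = gg σ' (dartRev G') := by
    apply gg_remove ι hι σ1 α1 σ' (dartRev G') hσ' hα'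
    intro x hx
    have : x = a ∨ x = b := by
      by_contra hc
      rw [not_or] at hc
      exact hx ((hr x).2 hc)
    rcases this with rfl | rfl
    · exact ⟨hσa, hαa⟩
    · exact ⟨hσb, hαb⟩
  have he : IsEmpty {x // ∀ w, ¬ G'.Adj x w} :=
    ⟨fun x => by obtain ⟨y, hy⟩ := hiso x.1; exact x.2 y hy⟩
  rw [Nat.card_of_isEmpty]
  change gg σ' (dartRev G') + _ = 0
  rw [← hgg, hg1]
  rfl

theorem planar_no_isolated {V : Type*} [Fintype V] {G : SimpleGraph V}
    (R : RotationSystem G) (hR : R.IsPlanarEmbedding) (x : V) : ∃ y, G.Adj x y := by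
  classical
  have := dart_finite G
  by_contra hc
  push Not at hc
  have h1 := (planar_iff R).1 hR
  have h2 := gg_nonneg R.σ (dartRev G)
  have : Nonempty {v // ∀ w, ¬ G.Adj v w} := ⟨⟨x, hc⟩⟩
  have h3 : 0 < Nat.card {v // ∀ w, ¬ G.Adj v w} := Nat.card_pos
  omega

end GraphPart

section ColorPart

def LocalColoring {V : Type*} (A : V → V → Prop) (cv : V → Fin 7) (ce : Sym2 V → Fin 7) : Prop :=
  (∀ x y, A x y → cv x ≠ cv y) ∧
  (∀ x y z, A x y → A x z → y ≠ z → ce s(x, y) ≠ ce s(x, z)) ∧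
  (∀ x y, A x y → ce s(x, y) ≠ cv x)

theorem totallyColorable_iff {V : Type*} (G : SimpleGraph V) :
    TotallyColorable G 7 ↔ ∃ cv ce, LocalColoring G.Adj cv ce := by
  constructor
  · rintro ⟨cv, ce, h1, h2, h3⟩
    refine ⟨cv, ce, h1, ?_, h3⟩
    intro x y z hy hz hyz
    refine h2 _ hy _ hz ?_ ⟨x, by simp, by simp⟩
    intro h
    exact hyz (Sym2.congr_right.1 h)
  · rintro ⟨cv, ce, h1, h2, h3⟩
    refine ⟨cv, ce, h1, ?_, h3⟩
    rintro e₁ he₁ e₂ he₂ hne ⟨x, hx1, hx2⟩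
    obtain ⟨y, rfl⟩ := hx1
    obtain ⟨z, rfl⟩ := hx2
    refine h2 x y z he₁ he₂ ?_
    rintro rfl
    exact hne rfl

theorem good_transfer {V W : Type*} [Fintype V] [Fintype W] {G : SimpleGraph V}
    {G' : SimpleGraph W} (f : G' →g G) (hf : Function.Injective f)
    (hle : ∀ v, vdeg G v ≤ 6) (hdeg : ∀ x, vdeg G' x ≤ vdeg G (f x))
    (hg : Good6Vertices G) : Good6Vertices G' := by
  have hed : ∀ {x} (c c' : G'.Walk x x), {e | e ∈ c.edges} ≠ {e | e ∈ c'.edges} →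
      {e | e ∈ (c.map f).edges} ≠ {e | e ∈ (c'.map f).edges} := by
    intro x c c' h h2
    apply h
    have hs : ∀ c : G'.Walk x x, {e | e ∈ (c.map f).edges} = Sym2.map f '' {e | e ∈ c.edges} := by
      intro c
      ext e
      simp [SimpleGraph.Walk.edges_map]
    rw [hs, hs] at h2
    exact (Set.image_injective.2 (Sym2.map.injective hf)) h2
  intro x hx
  have hx6 : vdeg G (f x) = 6 := le_antisymm (hle _) (hx ▸ hdeg x)
  rcases hg (f x) hx6 with h | h
  · left
    rintro ⟨c₁, c₂, h1, h2, l1, l2, hne, e, he1, he2⟩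
    refine h ⟨c₁.map f, c₂.map f, h1.map hf, h2.map hf, by simpa using l1, by simpa using l2,
      hed _ _ hne, Sym2.map f e, ?_, ?_⟩
    · rw [SimpleGraph.Walk.edges_map]; exact List.mem_map_of_mem he1
    · rw [SimpleGraph.Walk.edges_map]; exact List.mem_map_of_mem he2
  · right
    intro p q l hp
    rintro ⟨c₁, c₂, c₃, h1, h2, h3, l1, l2, l3, n1, n2, n3⟩
    exact h p q l hp ⟨c₁.map f, c₂.map f, c₃.map f, h1.map hf, h2.map hf, h3.map hf,
      by simpa using l1, by simpa using l2, by simpa using l3, hed _ _ n1, hed _ _ n2, hed _ _ n3⟩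

theorem color_delete {V : Type*} [Fintype V] (H : SimpleGraph V) (hmin : MinimalCounterexample H)
    (u v : V) (huv : H.Adj u v) (hu : ∃ y, y ≠ v ∧ H.Adj u y) (hv : ∃ y, y ≠ u ∧ H.Adj v y)
    (h6 : ∃ w, w ≠ u ∧ w ≠ v ∧ vdeg H w = 6) :
    ∃ cv ce, LocalColoring (fun x y => H.Adj x y ∧ s(x, y) ≠ s(u, v)) cv ce := by
  classical
  obtain ⟨⟨⟨R, hR⟩, ⟨hmax, -⟩, hdia, hhou, hgood⟩, hncol, hm⟩ := hmin
  let n := Fintype.card V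
  let f : Fin n ≃ V := (Fintype.equivFin V).symm
  let G : SimpleGraph (Fin n) :=
    { Adj := fun x y => H.Adj (f x) (f y) ∧ s(f x, f y) ≠ s(u, v)
      symm := ⟨fun x y h => ⟨h.1.symm, by rw [Sym2.eq_swap]; exact h.2⟩⟩
      loopless := ⟨fun x h => h.1.ne rfl⟩ }
  let φ : G →g H := ⟨f, fun h => h.1⟩
  have hφ : Function.Injective φ := f.injective
  have hle : ∀ x, vdeg G x ≤ vdeg H (f x) := by
    intro x
    refine Nat.card_le_card_of_injective
      (fun y : G.neighborSet x => (⟨f y.1, y.2.1⟩ : H.neighborSet (f x))) ?_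
    intro y z h
    exact Subtype.ext (f.injective (congrArg Subtype.val h))
  have hcol : TotallyColorable G 7 := by
    by_contra hG
    have hc := hm n G ⟨?_, ⟨fun x => (hle x).trans (hmax _), ?_⟩, ?_, ?_, ?_⟩ hG
    · have hlt : Nat.card G.edgeSet < Nat.card H.edgeSet := by
        let F : G.edgeSet → H.edgeSet := fun e => ⟨Sym2.map f e.1, by
          obtain ⟨e, he⟩ := e
          induction e using Sym2.ind with | _ x y => exact he.1⟩
        have hF : Function.Injective F := fun a b h =>
          Subtype.ext (Sym2.map.injective f.injective (congrArg Subtype.val h))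
        refine lt_of_le_of_ne (Nat.card_le_card_of_injective F hF) ?_
        intro heq
        obtain ⟨⟨e, he⟩, h2⟩ := ((Nat.bijective_iff_injective_and_card F).2 ⟨hF, heq⟩).2
          ⟨s(u, v), huv⟩
        induction e using Sym2.ind with | _ x y => exact he.2 (congrArg Subtype.val h2)
      omega
    · refine planar_delete R hR G f f.injective u v huv (fun _ _ => Iff.rfl) f.surjective ?_
      intro x
      have : ∃ y, H.Adj (f x) y ∧ s(f x, y) ≠ s(u, v) := by
        by_cases hxu : f x = u
        · obtain ⟨y, hy, hy'⟩ := hu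
          exact ⟨y, hxu ▸ hy', by rw [hxu]; intro h; exact hy (Sym2.congr_right.1 h)⟩
        by_cases hxv : f x = v
        · obtain ⟨y, hy, hy'⟩ := hv
          refine ⟨y, hxv ▸ hy', ?_⟩
          rw [hxv, Sym2.eq_swap]; intro h; exact hy (Sym2.congr_left.1 h)
        obtain ⟨y, hy⟩ := planar_no_isolated R hR (f x)
        refine ⟨y, hy, ?_⟩
        intro h
        have : f x ∈ s(u, v) := h ▸ Sym2.mem_mk_left _ _
        rw [Sym2.mem_iff] at this
        tauto
      obtain ⟨y, hy⟩ := this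
      obtain ⟨y, rfl⟩ := f.surjective y
      exact ⟨y, hy⟩
    · obtain ⟨w, hwu, hwv, hw⟩ := h6
      obtain ⟨x, rfl⟩ := f.surjective w
      refine ⟨x, le_antisymm ((hle x).trans (hmax _)) ?_⟩
      rw [← hw]
      refine Nat.card_le_card_of_injective
        (fun y : H.neighborSet (f x) => (⟨f.symm y.1, ?_⟩ : G.neighborSet x)) ?_
      · change H.Adj (f x) (f (f.symm y.1)) ∧ s(f x, f (f.symm y.1)) ≠ s(u, v)
        rw [f.apply_symm_apply]
        refine ⟨y.2, ?_⟩
        intro h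
        have : f x ∈ s(u, v) := h ▸ Sym2.mem_mk_left _ _
        rw [Sym2.mem_iff] at this
        tauto
      · intro y z h
        exact Subtype.ext (f.symm.injective (congrArg Subtype.val h))
    · rintro ⟨g, hg, hg'⟩
      exact hdia ⟨f ∘ g, f.injective.comp hg, fun a b h => (hg' h).1⟩
    · rintro ⟨g, hg, hg'⟩
      exact hhou ⟨f ∘ g, f.injective.comp hg, fun a b h => (hg' h).1⟩
    · exact good_transfer φ hφ hmax hle hgood
  obtain ⟨cv, ce, h1, h2, h3⟩ := (totallyColorable_iff G).1 hcol
  have hA : ∀ x y, H.Adj x y ∧ s(x, y) ≠ s(u, v) → G.Adj (f.symm x) (f.symm y) := by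
    intro x y h
    change H.Adj (f (f.symm x)) (f (f.symm y)) ∧ s(f (f.symm x), f (f.symm y)) ≠ s(u, v)
    rwa [f.apply_symm_apply, f.apply_symm_apply]
  refine ⟨fun x => cv (f.symm x), fun e => ce (e.map f.symm), ?_, ?_, ?_⟩
  · intro x y h
    exact h1 _ _ (hA _ _ h)
  · intro x y z h h' hne
    exact h2 _ _ _ (hA _ _ h) (hA _ _ h') (fun h => hne (f.symm.injective h))
  · intro x y h
    exact h3 _ _ (hA _ _ h)

theorem exists_color (a b c d : Fin 7) : ∃ x : Fin 7, x ≠ a ∧ x ≠ b ∧ x ≠ c ∧ x ≠ d := by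
  have h : ({a, b, c, d} : Finset (Fin 7)).card < (Finset.univ : Finset (Fin 7)).card :=
    lt_of_le_of_lt Finset.card_le_four (by decide)
  obtain ⟨x, -, hx⟩ := Finset.exists_mem_notMem_of_card_lt_card h
  simp only [Finset.mem_insert, Finset.mem_singleton, not_or] at hx
  exact ⟨x, hx.1, hx.2.1, hx.2.2.1, hx.2.2.2⟩

theorem two_nbrs {V : Type*} [Fintype V] {H : SimpleGraph V} {x p q : V} (h : vdeg H x = 2)
    (hp : H.Adj x p) (hq : H.Adj x q) (hpq : p ≠ q) : ∀ z, H.Adj x z ↔ z = p ∨ z = q := by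
  have h2 : (H.neighborSet x).ncard = 2 := h
  have : ({p, q} : Set V) = H.neighborSet x := by
    apply Set.eq_of_subset_of_ncard_le
    · rintro z (rfl | rfl)
      · exact hp
      · exact hq
    · rw [h2, Set.ncard_pair hpq]
    · exact Set.toFinite _
  intro z
  have := Set.ext_iff.1 this z
  simp only [Set.mem_insert_iff, Set.mem_singleton_iff, SimpleGraph.mem_neighborSet] at this
  exact this.symm

theorem two_other {V : Type*} [Fintype V] {H : SimpleGraph V} {x p : V} (h : vdeg H x = 2)
    (hp : H.Adj x p) : ∃ q, q ≠ p ∧ H.Adj x q := by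
  have h2 : 1 < (H.neighborSet x).ncard := by
    have : (H.neighborSet x).ncard = 2 := h
    omega
  obtain ⟨q, hq, hne⟩ := Set.exists_ne_of_one_lt_ncard h2 p
  exact ⟨q, hne, hq⟩

/-- No two adjacent 2-vertices. -/
theorem no_adjacent_two {V : Type*} [Fintype V] (H : SimpleGraph V)
    (hmin : MinimalCounterexample H) (u v : V) (huv : H.Adj u v) (hu : vdeg H u = 2)
    (hv : vdeg H v = 2) : False := by
  classical
  obtain ⟨u', hu'v, hu'⟩ := two_other hu huv
  obtain ⟨v', hv'u, hv'⟩ := two_other hv huv.symm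
  have hNu := two_nbrs hu huv hu' hu'v.symm
  have hNv := two_nbrs hv huv.symm hv' hv'u.symm
  have h6 : ∃ w, w ≠ u ∧ w ≠ v ∧ vdeg H w = 6 := by
    obtain ⟨w, hw⟩ := hmin.1.2.1.2
    refine ⟨w, ?_, ?_, hw⟩
    · rintro rfl; omega
    · rintro rfl; omega
  obtain ⟨cv, ce, h1, h2, h3⟩ := color_delete H hmin u v huv ⟨u', hu'v, hu'⟩ ⟨v', hv'u, hv'⟩ h6
  apply hmin.2.1
  rw [totallyColorable_iff]
  obtain ⟨c, hc1, hc2, -, -⟩ := exists_color (ce s(u, u')) (ce s(v, v')) 0 0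
  obtain ⟨a, ha1, ha2, ha3, -⟩ := exists_color (cv u') (ce s(u, u')) c 0
  obtain ⟨b, hb1, hb2, hb3, hb4⟩ := exists_color (cv v') (ce s(v, v')) c a
  have huvne : u ≠ v := huv.ne
  have hsym : ∀ x y, H.Adj x y → H.Adj y x := fun x y h => h.symm
  have hir : ∀ x y, H.Adj x y → x ≠ y := fun x y h => h.ne
  have hsw : ∀ x y : V, s(x, y) = s(y, x) := fun x y => Sym2.eq_swap
  have hne : ∀ x y, H.Adj x y → ¬ (x = u ∧ y = v) → ¬ (x = v ∧ y = u) → s(x, y) ≠ s(u, v) := by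
    intro x y _ ha hb h
    rw [Sym2.eq_iff] at h
    tauto
  obtain ⟨ce', hce'⟩ : ∃ ce' : Sym2 V → Fin 7, ce' = fun e => if e = s(u, v) then c else ce e :=
    ⟨_, rfl⟩
  have e1 : ce' s(u, v) = c := by simp [hce']
  have e2 : ce' s(v, u) = c := by simp [hce', Sym2.eq_swap]
  have e3 : ∀ x y, s(x, y) ≠ s(u, v) → ce' s(x, y) = ce s(x, y) := by
    intro x y h; simp [hce', h]
  obtain ⟨cv', hcv'⟩ : ∃ cv' : V → Fin 7, cv' = fun x => if x = u then a else if x = v then b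
    else cv x := ⟨_, rfl⟩
  have f1 : cv' u = a := by simp [hcv']
  have f2 : cv' v = b := by simp [hcv', huvne.symm]
  have f3 : ∀ x, x ≠ u → x ≠ v → cv' x = cv x := by
    intro x h h'; simp [hcv', h, h']
  have g1 : ∀ x y, H.Adj x y → x ≠ u → x ≠ v → cv x ≠ cv y :=
    fun x y h hu hv => h1 x y ⟨h, hne x y h (fun h => hu h.1) (fun h => hv h.1)⟩
  have g2 : ∀ x y z, H.Adj x y → H.Adj x z → y ≠ z → x ≠ u → x ≠ v →
      ce s(x, y) ≠ ce s(x, z) :=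
    fun x y z h h' hyz hu hv => h2 x y z ⟨h, hne x y h (fun h => hu h.1) (fun h => hv h.1)⟩
      ⟨h', hne x z h' (fun h => hu h.1) (fun h => hv h.1)⟩ hyz
  have g3 : ∀ x y, H.Adj x y → x ≠ u → x ≠ v → ce s(x, y) ≠ cv x :=
    fun x y h hu hv => h3 x y ⟨h, hne x y h (fun h => hu h.1) (fun h => hv h.1)⟩
  have e4 : ∀ x y, H.Adj x y → x ≠ u → x ≠ v → ce' s(x, y) = ce s(x, y) :=
    fun x y h hu hv => e3 x y (hne x y h (fun h => hu h.1) (fun h => hv h.1))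
  have e5 : ce' s(u, u') = ce s(u, u') :=
    e3 _ _ (hne _ _ hu' (fun h => hu'v h.2) (fun h => huvne h.1))
  have e6 : ce' s(v, v') = ce s(v, v') :=
    e3 _ _ (hne _ _ hv' (fun h => huvne h.1.symm) (fun h => hv'u h.2))
  clear hce' hcv' h1 h2 h3 e3 hne hsw h6 hmin
  obtain ⟨E, hE⟩ : ∃ E : V → V → Fin 7, ∀ x y, ce s(x, y) = E x y := ⟨_, fun _ _ => rfl⟩
  obtain ⟨E', hE'⟩ : ∃ E' : V → V → Fin 7, ∀ x y, ce' s(x, y) = E' x y := ⟨_, fun _ _ => rfl⟩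
  unfold LocalColoring
  refine ⟨cv', ce', ?_⟩
  simp only [hE, hE'] at *
  clear hE hE' ce ce'
  refine ⟨?_, ?_, ?_⟩
  · intro x y hxy
    have := hsym x y hxy
    have := g1 x y hxy
    have := f3 x
    have := f3 y
    have := hNu x
    have := hNu y
    have := hNv x
    have := hNv y
    clear g1 g2 g3 hsym e4
    grind
  · intro x y z hy hz hyz
    have := g2 x y z hy hz hyz
    have := e4 x y hy
    have := e4 x z hz
    have := hNu y
    have := hNu z
    have := hNv y
    have := hNv z
    clear g1 g2 g3 hsym e4 f3
    by_cases hxu : x = u <;> by_cases hxv : x = v <;> grind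
  · intro x y hxy
    have := g3 x y hxy
    have := e4 x y hxy
    have := f3 x
    have := hNu y
    have := hNv y
    clear g1 g2 g3 hsym e4
    by_cases hxu : x = u <;> by_cases hxv : x = v <;> grind

/-- two available colours at a vertex -/
theorem two_colors {V : Type*} [Fintype V] (H : SimpleGraph V) (p u w : V) (hd : vdeg H p ≤ 6)
    (hu : H.Adj p u) (hw : H.Adj p w) (huw : u ≠ w) (c0 : Fin 7) (ce : Sym2 V → Fin 7) :
    ∃ x y : Fin 7, x ≠ y ∧ x ≠ c0 ∧ y ≠ c0 ∧
      ∀ z, H.Adj p z → z ≠ u → z ≠ w → ce s(p, z) ≠ x ∧ ce s(p, z) ≠ y := by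
  classical
  let N := (Finset.univ.filter (fun z => H.Adj p z))
  let S : Finset (Fin 7) := insert c0 (((N.erase u).erase w).image (fun z => ce s(p, z)))
  have hN : N.card ≤ 6 := by
    have : vdeg H p = N.card := by
      unfold vdeg
      rw [Nat.card_eq_fintype_card, ← Set.toFinset_card]
      congr 1
      ext z
      simp [N]
    omega
  have h4 : ((N.erase u).erase w).card ≤ 4 := by
    rw [Finset.card_erase_of_mem, Finset.card_erase_of_mem]
    · omega
    · simp [N, hu]
    · simp [N, hw, huw.symm]
  have hS : S.card ≤ 5 :=
    (Finset.card_insert_le _ _).trans (Nat.succ_le_succ (Finset.card_image_le.trans h4))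
  have hSc : 1 < Sᶜ.card := by
    rw [Finset.card_compl, Fintype.card_fin]
    omega
  obtain ⟨x, hx, y, hy, hxy⟩ := Finset.one_lt_card.1 hSc
  rw [Finset.mem_compl, Finset.mem_insert, not_or] at hx hy
  refine ⟨x, y, hxy, hx.1, hy.1, ?_⟩
  intro z hz hzu hzw
  have hzm : z ∈ (N.erase u).erase w := by simp [N, hz, hzu, hzw]
  exact ⟨fun h => hx.2 (Finset.mem_image.2 ⟨z, hzm, h⟩),
    fun h => hy.2 (Finset.mem_image.2 ⟨z, hzm, h⟩)⟩

/-- Recolouring step for a 4-cycle with two opposite 2-vertices. -/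
theorem recolor_four {V : Type*} [Fintype V] (H : SimpleGraph V) (hmax : ∀ v, vdeg H v ≤ 6)
    (u w p q : V) (huw : u ≠ w) (hpq : p ≠ q)
    (hNu : ∀ z, H.Adj u z ↔ z = p ∨ z = q) (hNw : ∀ z, H.Adj w z ↔ z = p ∨ z = q)
    (cv : V → Fin 7) (ce : Sym2 V → Fin 7)
    (hc : LocalColoring (fun x y => H.Adj x y ∧ s(x, y) ≠ s(u, q)) cv ce) :
    TotallyColorable H 7 := by
  classical
  obtain ⟨h1, h2, h3⟩ := hc
  rw [totallyColorable_iff]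
  have up : H.Adj u p := (hNu p).2 (Or.inl rfl)
  have uq : H.Adj u q := (hNu q).2 (Or.inr rfl)
  have wp : H.Adj w p := (hNw p).2 (Or.inl rfl)
  have wq : H.Adj w q := (hNw q).2 (Or.inr rfl)
  obtain ⟨x, y, hxy, hx0, hy0, hP⟩ := two_colors H p u w (hmax p) up.symm wp.symm huw (cv p) ce
  obtain ⟨s, t, hst, hs0, ht0, hQ⟩ : ∃ s t : Fin 7, s ≠ t ∧ s ≠ cv q ∧ t ≠ cv q ∧
      (∀ z, H.Adj q z → z ≠ u → z ≠ w → ce s(q, z) ≠ s ∧ ce s(q, z) ≠ t) ∧ s ≠ x ∧ t ≠ y := by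
    obtain ⟨s, t, hst, hs0, ht0, hQ⟩ :=
      two_colors H q u w (hmax q) uq.symm wq.symm huw (cv q) ce
    by_cases h : s ≠ x ∧ t ≠ y
    · exact ⟨s, t, hst, hs0, ht0, hQ, h.1, h.2⟩
    · refine ⟨t, s, hst.symm, ht0, hs0, fun z a b c => ⟨(hQ z a b c).2, (hQ z a b c).1⟩, ?_, ?_⟩
      · grind
      · grind
  obtain ⟨hQ, hsx, hty⟩ := hQ
  obtain ⟨a, ha1, ha2, ha3, ha4⟩ := exists_color (cv p) (cv q) x s
  obtain ⟨b, hb1, hb2, hb3, hb4⟩ := exists_color (cv p) (cv q) y t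
  have hup : u ≠ p := up.ne
  have huq : u ≠ q := uq.ne
  have hwp : w ≠ p := wp.ne
  have hwq : w ≠ q := wq.ne
  obtain ⟨ce', hce'⟩ : ∃ ce' : Sym2 V → Fin 7, ce' = fun e => if e = s(u, p) then x else
    if e = s(u, q) then s else if e = s(w, p) then y else if e = s(w, q) then t else ce e :=
    ⟨_, rfl⟩
  have e1 : ce' s(u, p) = x := by simp [hce']
  have e2 : ce' s(u, q) = s := by
    simp only [hce', Sym2.eq_iff]; grind
  have e3 : ce' s(w, p) = y := by
    simp only [hce', Sym2.eq_iff]; grind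
  have e4 : ce' s(w, q) = t := by
    simp only [hce', Sym2.eq_iff]; grind
  have e5 : ce' s(p, u) = x := by rw [Sym2.eq_swap]; exact e1
  have e6 : ce' s(q, u) = s := by rw [Sym2.eq_swap]; exact e2
  have e7 : ce' s(p, w) = y := by rw [Sym2.eq_swap]; exact e3
  have e8 : ce' s(q, w) = t := by rw [Sym2.eq_swap]; exact e4
  have e9 : ∀ i j, i ≠ u → i ≠ w → j ≠ u → j ≠ w → ce' s(i, j) = ce s(i, j) := by
    intro i j ha hb hc hd
    simp [hce', Sym2.eq_iff, ha, hb, hc, hd]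
  obtain ⟨cv', hcv'⟩ : ∃ cv' : V → Fin 7, cv' = fun x => if x = u then a else if x = w then b
    else cv x := ⟨_, rfl⟩
  have f1 : cv' u = a := by simp [hcv']
  have f2 : cv' w = b := by simp [hcv', huw.symm]
  have f3 : ∀ x, x ≠ u → x ≠ w → cv' x = cv x := by
    intro x h h'; simp [hcv', h, h']
  have hne : ∀ i j, i ≠ u → j ≠ u → s(i, j) ≠ s(u, q) := by
    intro i j ha hb h
    rw [Sym2.eq_iff] at h
    tauto
  have hsym : ∀ x y, H.Adj x y → H.Adj y x := fun x y h => h.symm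
  have g1 : ∀ x y, H.Adj x y → x ≠ u → y ≠ u → cv x ≠ cv y :=
    fun x y h hu hv => h1 x y ⟨h, hne x y hu hv⟩
  have g2 : ∀ x y z, H.Adj x y → H.Adj x z → y ≠ z → x ≠ u → y ≠ u → z ≠ u →
      ce s(x, y) ≠ ce s(x, z) :=
    fun x y z h h' hyz hu hv hw => h2 x y z ⟨h, hne x y hu hv⟩ ⟨h', hne x z hu hw⟩ hyz
  have g3 : ∀ x y, H.Adj x y → x ≠ u → y ≠ u → ce s(x, y) ≠ cv x :=
    fun x y h hu hv => h3 x y ⟨h, hne x y hu hv⟩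
  clear hce' hcv' h1 h2 h3 hne hmax
  obtain ⟨E, hE⟩ : ∃ E : V → V → Fin 7, ∀ x y, ce s(x, y) = E x y := ⟨_, fun _ _ => rfl⟩
  obtain ⟨E', hE'⟩ : ∃ E' : V → V → Fin 7, ∀ x y, ce' s(x, y) = E' x y := ⟨_, fun _ _ => rfl⟩
  unfold LocalColoring
  refine ⟨cv', ce', ?_⟩
  simp only [hE, hE'] at *
  clear hE hE' ce ce'
  refine ⟨?_, ?_, ?_⟩
  · intro i j hij
    have := hsym i j hij
    have := g1 i j hij
    have := f3 i
    have := f3 j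
    have := hNu i
    have := hNu j
    have := hNw i
    have := hNw j
    clear g1 g2 g3 hsym e9 hP hQ hNu hNw
    by_cases hiu : i = u <;> by_cases hiw : i = w <;> by_cases hju : j = u <;>
      by_cases hjw : j = w <;> grind
  · intro i j k hj hk hjk
    have := hsym i j hj
    have := hsym i k hk
    have := g2 i j k hj hk hjk
    have := e9 i j
    have := e9 i k
    have := hP j
    have := hP k
    have := hQ j
    have := hQ k
    have := hNu i
    have := hNw i
    have := hNu j
    have := hNw j
    have := hNu k
    have := hNw k
    clear g1 g2 g3 hsym e9 hP hQ hNu hNw f3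
    by_cases hiu : i = u
    · subst hiu; grind
    by_cases hiw : i = w
    · subst hiw; grind
    by_cases hju : j = u <;> by_cases hjw : j = w <;> by_cases hku : k = u <;>
      by_cases hkw : k = w <;> by_cases hip : i = p <;> by_cases hiq : i = q <;> grind
  · intro i j hij
    have := hsym i j hij
    have := g3 i j hij
    have := e9 i j
    have := f3 i
    have := hNu i
    have := hNw i
    have := hNu j
    have := hNw j
    clear g1 g2 g3 hsym e9 hP hQ hNu hNw
    by_cases hiu : i = u <;> by_cases hiw : i = w <;> by_cases hju : j = u <;>
      by_cases hjw : j = w <;> grind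

theorem no_opposite_two {V : Type*} [Fintype V] (H : SimpleGraph V)
    (hmin : MinimalCounterexample H) (u w p q : V) (huw : u ≠ w) (hpq : p ≠ q)
    (hu : vdeg H u = 2) (hw : vdeg H w = 2)
    (up : H.Adj u p) (uq : H.Adj u q) (wp : H.Adj w p) (wq : H.Adj w q) : False := by
  have hmax := hmin.1.2.1.1
  obtain ⟨z, hz⟩ := hmin.1.2.1.2
  have hzu : z ≠ u := by rintro rfl; omega
  have hNu := two_nbrs hu up uq hpq
  have hNw := two_nbrs hw wp wq hpq
  by_cases hzq : z = q
  · obtain ⟨cv, ce, hc⟩ := color_delete H hmin u p up ⟨q, hpq.symm, uq⟩ ⟨w, huw.symm, wp.symm⟩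
      ⟨z, hzu, by rw [hzq]; exact hpq.symm, hz⟩
    exact hmin.2.1 (recolor_four H hmax u w q p huw hpq.symm (fun z => (hNu z).trans or_comm)
      (fun z => (hNw z).trans or_comm) cv ce hc)
  · obtain ⟨cv, ce, hc⟩ := color_delete H hmin u q uq ⟨p, hpq, up⟩ ⟨w, huw.symm, wq.symm⟩
      ⟨z, hzu, hzq, hz⟩
    exact hmin.2.1 (recolor_four H hmax u w p q huw hpq hNu hNw cv ce hc)

theorem orbit_four {D : Type*} [Finite D] (π : Equiv.Perm D) (d : D)
    (h : {d' | π.SameCycle d d'}.ncard = 4) :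
    π (π (π (π d))) = d ∧ ∀ d', π.SameCycle d d' →
      d' = d ∨ d' = π d ∨ d' = π (π d) ∨ d' = π (π (π d)) := by
  classical
  set k := Function.minimalPeriod π d with hk
  have hkpos : 0 < k := by
    apply Function.minimalPeriod_pos_of_mem_periodicPts
    exact π.injective.mem_periodicPts d
  have hit : ∀ n : ℕ, (π ^ n) d = π^[n] d := by
    intro n; rw [Equiv.Perm.iterate_eq_pow]
  have hset : {d' | π.SameCycle d d'} = ((Finset.range k).image (fun n => π^[n] d) : Finset D) := by
    ext d'
    simp only [Set.mem_ofPred_eq, Finset.coe_image, Set.mem_image, Finset.coe_range, Set.mem_Iio]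
    constructor
    · intro hs
      obtain ⟨n, hn⟩ := hs.exists_nat_pow_eq
      refine ⟨n % k, Nat.mod_lt _ hkpos, ?_⟩
      rw [hk, Function.iterate_mod_minimalPeriod_eq, ← hit, hn]
    · rintro ⟨n, -, rfl⟩
      exact ⟨n, by rw [zpow_natCast, hit]⟩
  have hk4 : k = 4 := by
    rw [hset, Set.ncard_coe_finset, Finset.card_image_of_injOn, Finset.card_range] at h
    · exact h
    · intro a ha b hb hab
      rw [Finset.coe_range, Set.mem_Iio] at ha hb
      exact Function.iterate_injOn_Iio_minimalPeriod ha hb hab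
  constructor
  · have := Function.iterate_minimalPeriod (f := π) (x := d)
    rw [← hk, hk4] at this
    exact this
  · intro d' hd'
    have : d' ∈ {d' | π.SameCycle d d'} := hd'
    rw [hset, hk4] at this
    simp only [Finset.coe_image, Set.mem_image, Finset.coe_range, Set.mem_Iio] at this
    obtain ⟨n, hn, rfl⟩ := this
    interval_cases n <;> simp

end ColorPart

/-- **Lemma (4-faces).** In a minimal counterexample, every 4-face is incident with at
most one vertex of degree 2. -/
theorem minimal_counterexample_four_face_at_most_one_two_vertex
    {V : Type*} [Fintype V] (H : SimpleGraph V)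
    (hmin : MinimalCounterexample H)
    (R : RotationSystem H) (hR : R.IsPlanarEmbedding)
    (d : H.Dart) (hf : R.faceDeg d = 4) :
    {v | R.FaceIncident v d ∧ vdeg H v = 2}.Subsingleton := by
  classical
  have hfin := dart_finite H
  rintro x ⟨⟨d0, hd0, rfl⟩, hx⟩ y ⟨⟨d1, hd1, rfl⟩, hy⟩
  by_contra hne
  have hd0 : R.φ.SameCycle d d0 := hd0
  have hd1 : R.φ.SameCycle d d1 := hd1
  have hcard : {d' | R.φ.SameCycle d0 d'}.ncard = 4 := by
    rw [← hf]
    unfold RotationSystem.faceDeg RotationSystem.faceDarts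
    congr 1
    ext d'
    exact ⟨fun h => hd0.trans h, fun h => hd0.symm.trans h⟩
  obtain ⟨h4, hor⟩ := orbit_four R.φ d0 hcard
  have hfst : ∀ e : H.Dart, (R.φ e).fst = e.snd := fun e => R.tail_fixed _
  rcases hor d1 (hd0.symm.trans hd1) with rfl | rfl | rfl | rfl
  · exact hne rfl
  · refine no_adjacent_two H hmin d0.fst (R.φ d0).fst ?_ hx hy
    rw [hfst]; exact d0.adj
  · have a0 := d0.adj
    have a1 := (R.φ d0).adj
    have a2 := (R.φ (R.φ d0)).adj
    have a3 := (R.φ (R.φ (R.φ d0))).adj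
    have h30 : (R.φ (R.φ (R.φ d0))).snd = d0.fst := by rw [← hfst, h4]
    rw [hfst] at a1
    rw [hfst (R.φ (R.φ d0)), h30] at a3
    rw [← hfst (R.φ d0)] at a1
    refine no_opposite_two H hmin d0.fst (R.φ (R.φ d0)).fst d0.snd (R.φ (R.φ d0)).snd hne ?_ hx hy
      a0 a3.symm a1.symm a2
    intro heq
    have hs : (R.φ (R.φ (R.φ d0))) = d0.symm := by
      apply SimpleGraph.Dart.ext
      refine Prod.ext ?_ h30
      change (R.φ (R.φ (R.φ d0))).fst = d0.snd
      rw [hfst, heq]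
    have hfix : R.σ d0 = d0 := by
      have h5 : R.σ (R.φ (R.φ (R.φ d0))).symm = d0 := h4
      rwa [hs, SimpleGraph.Dart.symm_symm] at h5
    obtain ⟨q, hq, hadj⟩ := two_other hx d0.adj
    obtain ⟨i, hi⟩ := R.vertex_cycles d0 ⟨(d0.fst, q), hadj⟩ rfl
    rw [Equiv.Perm.zpow_apply_eq_self_of_apply_eq_self hfix i] at hi
    exact hq (congrArg (fun e : H.Dart => e.snd) hi).symm
  · refine no_adjacent_two H hmin (R.φ (R.φ (R.φ d0))).fst d0.fst ?_ hy hx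
    have h30 : (R.φ (R.φ (R.φ d0))).snd = d0.fst := by rw [← hfst, h4]
    rw [← h30]
    exact (R.φ (R.φ (R.φ d0))).adj
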